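/- Suppose in addition that the hypergraph is d-regular and d-uniform with d = k ≥ 2 and E nonempty: every vertex of Fin n has degree d and every hyperedge has cardinality d. Then d is an eigenvalue of the e-adjacency tensor r: the vector x ∈ ℂ^N with x(i) = 1 for the n original-vertex indices and x(i) = 0 for the k - 1 additional indices is an eigenvector for the eigenvalue d. In particular the bound max(Δ, Δ*) = d of the eigenvalue-localization theorem is attained. -/

import Mathlib

open Finset

/-- Embedding of the original vertices `Fin n` into the extended vertex set `Fin (n + k - 1)`. -/
def emb (n k : ℕ) (hk : 1 ≤ k) (v : Fin n) : Fin (n + k - 1) :=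
  ⟨(v : ℕ), by have := v.isLt; omega⟩

/-- The additional vertex `y_{j+1}` corresponds to the index `n + j` of `Fin (n + k - 1)`. -/
def addIdx (n k : ℕ) (j : Fin (k - 1)) : Fin (n + k - 1) :=
  ⟨n + (j : ℕ), by have := j.isLt; omega⟩

/-- The set of additional indices `{n+s-1, ..., n+k-2}` used to fill a hyperedge `e`
of cardinality `s`. -/
def addSet (n k : ℕ) (e : Finset (Fin n)) : Finset (Fin (n + k - 1)) :=
  (Finset.univ.filter fun j : Fin (k - 1) => e.card - 1 ≤ (j : ℕ)).image (addIdx n k)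

/-- The filled hyperedge `ê ⊆ Fin (n + k - 1)` of a hyperedge `e ⊆ Fin n`. -/
def filled (n k : ℕ) (hk : 1 ≤ k) (e : Finset (Fin n)) : Finset (Fin (n + k - 1)) :=
  e.image (emb n k hk) ∪ addSet n k e

/-- The e-adjacency tensor of the hypergraph with hyperedge family `E`:
`r t = 1/(k-1)!` if `t` is injective with image a filled hyperedge, and `0` otherwise. -/
noncomputable def eAdj (n k : ℕ) (hk : 1 ≤ k) (E : Finset (Finset (Fin n))) :
    (Fin k → Fin (n + k - 1)) → ℝ := fun t =>
  if Function.Injective t ∧ ∃ e ∈ E, Finset.image t Finset.univ = filled n k hk e then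
    1 / (Nat.factorial (k - 1)) else 0

/-- The degree of a vertex `v`: the number of hyperedges containing `v`. -/
def deg (n : ℕ) (E : Finset (Finset (Fin n))) (v : Fin n) : ℕ :=
  (E.filter fun e => v ∈ e).card

/-- The tuple `(i, t 0, ..., t (m-2)) : Fin m → Fin N`. -/
def extend (m N : ℕ) (i : Fin N) (t : Fin (m - 1) → Fin N) : Fin m → Fin N :=
  fun j => if h : (j : ℕ) = 0 then i else t ⟨(j : ℕ) - 1, by have := j.isLt; omega⟩

/-- `(lam, x)` is an eigenpair of the order-`m`, dimension-`N` hypermatrix `T`. -/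
def IsEigenpair (m N : ℕ) (T : (Fin m → Fin N) → ℝ) (lam : ℂ) (x : Fin N → ℂ) : Prop :=
  x ≠ 0 ∧ ∀ i : Fin N,
    ∑ t : Fin (m - 1) → Fin N, (T (extend m N i t) : ℂ) * ∏ j : Fin (m - 1), x (t j)
      = lam * x i ^ (m - 1)


/-- A finset of cardinality `m` has `m!` injective enumerations by `Fin m`. -/
lemma card_injective_image_eq {α : Type*} [Fintype α] [DecidableEq α] {m : ℕ} {S : Finset α}
    (hS : S.card = m) :
    (univ.filter fun t : Fin m → α => Function.Injective t ∧ image t univ = S).card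
      = m.factorial := by
  have h : (univ.filter fun t : Fin m → α => Function.Injective t ∧ image t univ = S)
      = (univ : Finset (Fin m ↪ S)).image fun f j => (f j : α) := by
    ext t
    simp only [mem_filter, mem_univ, true_and, mem_image]
    constructor
    · rintro ⟨hinj, him⟩
      refine ⟨⟨fun j => ⟨t j, him ▸ mem_image_of_mem t (mem_univ j)⟩, fun a b hab => ?_⟩, rfl⟩
      exact hinj (congrArg Subtype.val hab)
    · rintro ⟨f, rfl⟩
      have hinj : Function.Injective fun j => (f j : α) :=
        Subtype.val_injective.comp f.injective
      refine ⟨hinj, eq_of_subset_of_card_le ?_ ?_⟩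
      · exact image_subset_iff.2 fun j _ => (f j).2
      · rw [card_image_of_injective _ hinj, hS, card_univ, Fintype.card_fin]
  rw [h, card_image_of_injective]
  · rw [card_univ, Fintype.card_embedding_eq, Fintype.card_coe, hS, Fintype.card_fin,
      Nat.descFactorial_self]
  · intro f g hfg
    ext j
    exact congrFun hfg j

/-- The number of injective enumerations of `S` by `Fin (m + 1)` starting with `i`. -/
lemma card_cons_injective_image_eq {α : Type*} [Fintype α] [DecidableEq α] {m : ℕ}
    {S : Finset α} (hS : S.card = m + 1) (i : α) :
    (univ.filter fun t : Fin m → α => Function.Injective (Fin.cons i t : Fin (m + 1) → α) ∧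
      image (Fin.cons i t : Fin (m + 1) → α) univ = S).card
      = if i ∈ S then m.factorial else 0 := by
  have him (t : Fin m → α) :
      image (Fin.cons i t : Fin (m + 1) → α) univ = insert i (image t univ) := by
    ext a
    simp [Fin.exists_fin_succ, eq_comm]
  split_ifs with hi
  · rw [← card_injective_image_eq (S := S.erase i) (m := m)
      (by rw [card_erase_of_mem hi, hS, Nat.add_sub_cancel])]
    congr 1
    ext t
    simp only [mem_filter, mem_univ, true_and, him, Fin.cons_injective_iff]
    constructor
    · rintro ⟨⟨hit, hinj⟩, rfl⟩
      refine ⟨hinj, (erase_insert ?_).symm⟩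
      simpa using hit
    · rintro ⟨hinj, h⟩
      refine ⟨⟨?_, hinj⟩, by rw [h, insert_erase hi]⟩
      have : i ∉ image t univ := by simp [h]
      simpa using this
  · rw [card_eq_zero, filter_eq_empty_iff]
    rintro t - ⟨-, h⟩
    exact hi (h ▸ him t ▸ mem_insert_self i _)

lemma extend_succ (m N : ℕ) (i : Fin N) (t : Fin m → Fin N) :
    extend (m + 1) N i t = (Fin.cons i t : Fin (m + 1) → Fin N) := by
  funext j
  refine Fin.cases ?_ (fun j => ?_) j
  · simp [extend]
  · simp [extend]

lemma emb_injective (n k : ℕ) (hk : 1 ≤ k) : Function.Injective (emb n k hk) := by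
  intro a b h
  exact Fin.ext (Fin.mk.inj h)

/-- A hyperedge of maximal cardinality needs no filling. -/
lemma filled_of_card_eq {n k : ℕ} (hk : 1 ≤ k) {e : Finset (Fin n)} (he : e.card = k) :
    filled n k hk e = e.image (emb n k hk) := by
  have : addSet n k e = ∅ := by
    rw [addSet, image_eq_empty, filter_eq_empty_iff]
    intro j _
    have := j.isLt
    omega
  rw [filled, this, union_empty]

/-- On a uniform hypergraph, the row sums of the e-adjacency tensor weighted by the indicator of
the original vertices count the filled hyperedges through an index. -/
lemma sum_eAdj_of_uniform {n m : ℕ} {E : Finset (Finset (Fin n))}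
    (hunif : ∀ e ∈ E, e.card = m + 1) (i : Fin (n + (m + 1) - 1)) :
    ∑ t : Fin m → Fin (n + (m + 1) - 1),
      (eAdj n (m + 1) (by omega) E (extend (m + 1) _ i t) : ℂ) *
        ∏ j : Fin m, (if (t j : ℕ) < n then (1 : ℂ) else 0)
      = (E.filter fun e => i ∈ e.image (emb n (m + 1) (by omega))).card := by
  have hk : 1 ≤ m + 1 := by omega
  have hfac : (m.factorial : ℂ) ≠ 0 := by exact_mod_cast m.factorial_ne_zero
  have hterm (t : Fin m → Fin (n + (m + 1) - 1)) :
      (eAdj n (m + 1) hk E (extend (m + 1) _ i t) : ℂ) *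
        ∏ j : Fin m, (if (t j : ℕ) < n then (1 : ℂ) else 0)
      = ∑ e ∈ E, if Function.Injective (Fin.cons i t : Fin (m + 1) → Fin (n + (m + 1) - 1)) ∧
          image (Fin.cons i t : Fin (m + 1) → Fin (n + (m + 1) - 1)) univ
            = e.image (emb n (m + 1) hk) then 1 / (m.factorial : ℂ) else 0 := by
    rw [extend_succ, eAdj]
    split_ifs with h
    · obtain ⟨hinj, e, he, him⟩ := h
      rw [filled_of_card_eq hk (hunif e he)] at him
      have hprod : ∏ j : Fin m, (if (t j : ℕ) < n then (1 : ℂ) else 0) = 1 := by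
        refine prod_eq_one fun j _ => if_pos ?_
        have hj : t j ∈ e.image (emb n (m + 1) hk) := by
          rw [← him]
          exact mem_image.2 ⟨j.succ, mem_univ _, Fin.cons_succ _ _ _⟩
        obtain ⟨v, -, hv⟩ := mem_image.1 hj
        rw [← hv]
        exact v.isLt
      rw [hprod, sum_eq_single_of_mem e he, if_pos ⟨hinj, him⟩]
      · simp
      · rintro e' - hne
        refine if_neg fun h => hne ?_
        exact image_injective (emb_injective n (m + 1) hk) (h.2.symm.trans him)
    · rw [sum_eq_zero]
      · simp
      · intro e he
        refine if_neg fun h' => h ⟨h'.1, e, he, ?_⟩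
        rw [filled_of_card_eq hk (hunif e he)]
        exact h'.2
  rw [sum_congr rfl fun t _ => hterm t, sum_comm, card_filter, Nat.cast_sum]
  refine sum_congr rfl fun e he => ?_
  have hcard : (e.image (emb n (m + 1) hk)).card = m + 1 := by
    rw [card_image_of_injective _ (emb_injective n (m + 1) hk), hunif e he]
  rw [← sum_filter, sum_const, card_cons_injective_image_eq hcard i]
  split_ifs
  · simp [hfac]
  · simp

/-- For a `k`-regular `k`-uniform hypergraph (with nonempty hyperedge family), `k` is an
eigenvalue of the e-adjacency tensor, with eigenvector equal to `1` on the original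
vertices and `0` on the additional vertices; moreover the bound `max (Δ, Δ*)` of the
eigenvalue-localization theorem equals `k`, hence is attained. -/
theorem eAdj_regular_uniform_eigenvalue (n k : ℕ) (hn : 1 ≤ n) (hk : 2 ≤ k)
    (E : Finset (Finset (Fin n))) (hEne : E.Nonempty)
    (hE1 : ∀ e ∈ E, e.Nonempty) (hE2 : ∀ e ∈ E, e.card ≤ k)
    (hreg : ∀ v : Fin n, deg n E v = k) (hunif : ∀ e ∈ E, e.card = k) :
    IsEigenpair k (n + k - 1) (eAdj n k (by omega) E) (k : ℂ)
        (fun i => if (i : ℕ) < n then 1 else 0) ∧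
      max (Finset.univ.sup fun i : Fin n => deg n E i)
        ((Finset.Icc 1 (k - 1)).sup fun j => (E.filter fun e => e.card ≤ j).card) = k := by
  have : NeZero n := ⟨by omega⟩
  obtain ⟨m, rfl⟩ : ∃ m, k = m + 1 := ⟨k - 1, by omega⟩
  refine ⟨⟨fun h => ?_, fun i => ?_⟩, ?_⟩
  · have := congrFun h (emb n (m + 1) (by omega) 0)
    simp [emb, NeZero.pos n] at this
  · refine (sum_eAdj_of_uniform hunif i).trans ?_
    by_cases hi : (i : ℕ) < n
    · obtain ⟨v, rfl⟩ : ∃ v, emb n (m + 1) m.succ_pos v = i := ⟨⟨i, hi⟩, rfl⟩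
      simp only [if_pos hi, one_pow, mul_one, (emb_injective n (m + 1) _).mem_finset_image]
      exact congrArg Nat.cast (hreg v)
    · have hm : m ≠ 0 := by omega
      rw [filter_false_of_mem]
      · simp [hm, hi]
      · intro e _ hie
        obtain ⟨v, -, rfl⟩ := mem_image.1 hie
        exact hi v.isLt
  · have hstar : ((Icc 1 (m + 1 - 1)).sup fun j => (E.filter fun e => e.card ≤ j).card) = 0 := by
      refine Nat.le_zero.1 (Finset.sup_le fun j hj => ?_)
      rw [filter_false_of_mem]
      · simp
      · intro e he
        have := hunif e he
        have := (mem_Icc.1 hj).2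
        omega
    rw [hstar, Nat.max_zero, sup_congr rfl fun i _ => hreg i, sup_const univ_nonempty]
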